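/- arXiv:2212.07121 — 5 statements merged into one kernel-verified Lean document; each statement's English description precedes it below -/
import Mathlib

section
/- Let 0 ≤ ε ≤ π/8 and let (τ_i)_{1≤i≤m}, (t_i)_{1≤i≤m} be real sequences such that: |τ_{i+1} − τ_i| ≤ π/4 for all 1 ≤ i ≤ m−1; for every i there exists an integer n_i with |t_i − τ_i − n_i·π| ≤ ε; |t_{i+1} − t_i| < π/2 for all 1 ≤ i ≤ m−1; and |t_1 − τ_1| ≤ ε. Then |t_i − τ_i| ≤ ε for every 1 ≤ i ≤ m. -/
open Real

/-- Stability of the lift modulo `π`: if the exact phases `τ_i` vary slowly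
(consecutive gaps `≤ π/4`), the approximate phases `t_i` agree with `τ_i` within
`ε ≤ π/8` modulo `π`, have consecutive gaps `< π/2`, and `|t₁ − τ₁| ≤ ε`, then
`|t_i − τ_i| ≤ ε` for every `1 ≤ i ≤ m`. -/
theorem lift_mod_pi_stable (m : ℕ) (ε : ℝ) (hε0 : 0 ≤ ε) (hε : ε ≤ Real.pi / 8)
    (τ t : ℕ → ℝ)
    (hτgap : ∀ i, 1 ≤ i → i ≤ m - 1 → |τ (i + 1) - τ i| ≤ Real.pi / 4)
    (hmod : ∀ i, 1 ≤ i → i ≤ m → ∃ n : ℤ, |t i - τ i - n * Real.pi| ≤ ε)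
    (htgap : ∀ i, 1 ≤ i → i ≤ m - 1 → |t (i + 1) - t i| < Real.pi / 2)
    (hfirst : |t 1 - τ 1| ≤ ε) :
    ∀ i, 1 ≤ i → i ≤ m → |t i - τ i| ≤ ε := by
  intro i hi
  induction i, hi using Nat.le_induction with
  | base => exact fun _ => hfirst
  | succ k hk ih =>
    intro hkm
    have hprev := abs_le.mp (ih (by omega))
    have hτ := abs_le.mp (hτgap k hk (by omega))
    have ht := abs_lt.mp (htgap k hk (by omega))
    obtain ⟨n, hn⟩ := hmod (k + 1) (by omega) hkm
    have hn' := abs_le.mp hn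
    have hπ := Real.pi_pos
    have hlt : (n : ℝ) < 1 := by
      by_contra! h
      nlinarith [mul_le_mul_of_nonneg_right h hπ.le]
    have hgt : (-1 : ℝ) < n := by
      by_contra! h
      nlinarith [mul_le_mul_of_nonneg_right h hπ.le]
    have hlt' : n < 1 := by exact_mod_cast hlt
    have hgt' : -1 < n := by exact_mod_cast hgt
    obtain rfl : n = 0 := by omega
    simpa using hn
end

section
/- Let θ, η > 0, h_max > 0, N ≥ 1 an integer, k > 0, and let h be differentiable on an interval [x*, x̄] with θ·η ≤ h'(t) and 0 < h(t) ≤ h_max for all t ∈ [x*, x̄], and h(x*) = Nπ/k. Then for every z ∈ [x*, x̄], k² − N²π²/h(z)² ≥ (2N²π²θη/h_max³)·(z − x*); in particular the local wavenumber satisfies k_N(z) = √(k² − N²π²/h(z)²) ≥ Nπ·√(2θ/h_max³)·√η·√(z − x*). -/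
open Real Set

/-- Lower bound for the increment of `-1 / x ^ 2` on `(0, M]`. -/
lemma two_mul_sub_div_cube_le {a b M : ℝ} (ha : 0 < a) (hab : a ≤ b) (hbM : b ≤ M) :
    2 * (b - a) / M ^ 3 ≤ 1 / a ^ 2 - 1 / b ^ 2 := by
  have hb : 0 < b := ha.trans_le hab
  have hsub : 0 ≤ b - a := sub_nonneg.2 hab
  calc 2 * (b - a) / M ^ 3 ≤ 2 * (b - a) / b ^ 3 := by gcongr
    _ ≤ 1 / a ^ 2 - 1 / b ^ 2 := by
      have key : 1 / a ^ 2 - 1 / b ^ 2 - 2 * (b - a) / b ^ 3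
          = (b - a) ^ 2 * (b + 2 * a) / (a ^ 2 * b ^ 3) := by
        field_simp
        ring
      have : 0 ≤ (b - a) ^ 2 * (b + 2 * a) / (a ^ 2 * b ^ 3) := by positivity
      linarith

/-- Square-root lower bound on the local wavenumber near the resonant point:
if `h` is differentiable on `[x*, x̄]` with `θη ≤ h'` and `0 < h ≤ h_max` there,
and `h(x*) = Nπ/k`, then for every `z ∈ [x*, x̄]` one has
`k² − N²π²/h(z)² ≥ (2N²π²θη/h_max³)(z − x*)` and
`√(k² − N²π²/h(z)²) ≥ Nπ·√(2θ/h_max³)·√η·√(z − x*)`. -/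
theorem wavenumber_sqrt_lower_bound
    (θ η h_max : ℝ) (hθ : 0 < θ) (hη : 0 < η) (hmax : 0 < h_max)
    (N : ℕ) (hN : 1 ≤ N) (k : ℝ) (hk : 0 < k)
    (xstar xbar : ℝ) (h h' : ℝ → ℝ)
    (hderiv : ∀ t ∈ Set.Icc xstar xbar, HasDerivAt h (h' t) t)
    (hlow : ∀ t ∈ Set.Icc xstar xbar, θ * η ≤ h' t)
    (hpos : ∀ t ∈ Set.Icc xstar xbar, 0 < h t)
    (hub : ∀ t ∈ Set.Icc xstar xbar, h t ≤ h_max)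
    (hres : h xstar = N * Real.pi / k) :
    ∀ z ∈ Set.Icc xstar xbar,
      (2 * N ^ 2 * Real.pi ^ 2 * θ * η / h_max ^ 3) * (z - xstar) ≤
        k ^ 2 - N ^ 2 * Real.pi ^ 2 / (h z) ^ 2 ∧
      N * Real.pi * Real.sqrt (2 * θ / h_max ^ 3) * Real.sqrt η * Real.sqrt (z - xstar) ≤
        Real.sqrt (k ^ 2 - N ^ 2 * Real.pi ^ 2 / (h z) ^ 2) := by
  intro z hz
  have hx : xstar ∈ Set.Icc xstar xbar := ⟨le_rfl, hz.1.trans hz.2⟩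
  have hmvt : θ * η * (z - xstar) ≤ h z - h xstar := by
    refine (convex_Icc xstar xbar).mul_sub_le_image_sub_of_le_deriv
      (fun t ht => (hderiv t ht).continuousAt.continuousWithinAt)
      (fun t ht => (hderiv t (interior_subset ht)).differentiableAt.differentiableWithinAt)
      (fun t ht => ?_) xstar hx z hz hz.1
    rw [(hderiv t (interior_subset ht)).deriv]
    exact hlow t (interior_subset ht)
  have hzx : 0 ≤ z - xstar := sub_nonneg.2 hz.1
  have hab : h xstar ≤ h z := by
    have : 0 ≤ θ * η * (z - xstar) := by positivity
    linarith
  have hN' : (0 : ℝ) < N := by exact_mod_cast hN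
  have hk2 : k ^ 2 = N ^ 2 * Real.pi ^ 2 * (1 / h xstar ^ 2) := by
    rw [hres]
    field_simp
  have hsq : (2 * N ^ 2 * Real.pi ^ 2 * θ * η / h_max ^ 3) * (z - xstar) ≤
      k ^ 2 - N ^ 2 * Real.pi ^ 2 / (h z) ^ 2 := by
    calc (2 * N ^ 2 * Real.pi ^ 2 * θ * η / h_max ^ 3) * (z - xstar)
        = N ^ 2 * Real.pi ^ 2 * (2 * (θ * η * (z - xstar)) / h_max ^ 3) := by ring
      _ ≤ N ^ 2 * Real.pi ^ 2 * (2 * (h z - h xstar) / h_max ^ 3) := by gcongr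
      _ ≤ N ^ 2 * Real.pi ^ 2 * (1 / h xstar ^ 2 - 1 / h z ^ 2) := by
        gcongr
        exact two_mul_sub_div_cube_le (hpos xstar hx) hab (hub z hz)
      _ = k ^ 2 - N ^ 2 * Real.pi ^ 2 / (h z) ^ 2 := by
        rw [hk2]
        ring
  refine ⟨hsq, Real.le_sqrt_of_sq_le (le_trans (le_of_eq ?_) hsq)⟩
  rw [mul_pow, mul_pow, mul_pow, mul_pow, Real.sq_sqrt (by positivity), Real.sq_sqrt hη.le,
    Real.sq_sqrt hzx]
  ring
end

section
/- For all integers N ≥ 1 and reals θ > 0, 0 < h_min ≤ h_max, there exists a constant C > 0 (one may take C = √2·Nπ·h_max^{3/2}/(h_min³·√θ)) such that the following holds: for every η > 0, every k > 0, and every h differentiable on [x*, z] with θη ≤ h'(t) ≤ η and h_min ≤ h(t) ≤ h_max for all t, and h(x*) = Nπ/k, one has ∫_{x*}^{z} |k_N(t) − k_N(z)| dt ≤ C·η^{1/2}·(z − x*)^{3/2}, where k_N(t) = √(k² − N²π²/h(t)²). -/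
open Real Set

theorem rpow_three_halves {x : ℝ} (hx : 0 ≤ x) : x ^ ((3 : ℝ) / 2) = x * √x := by
  rw [Real.sqrt_eq_rpow, show ((3 : ℝ) / 2) = 1 + 1 / 2 by norm_num,
    Real.rpow_add' hx (by norm_num), Real.rpow_one]

theorem div_sq_sub_div_sq_le {A a b m d : ℝ} (hm : 0 < m) (ha : m ≤ a) (hb : m ≤ b)
    (hd : 0 ≤ d) (hab : b - a ≤ d) :
    (A / a) ^ 2 - A ^ 2 / b ^ 2 ≤ 2 * A ^ 2 * d / m ^ 3 := by
  have ha0 : 0 < a := hm.trans_le ha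
  have hb0 : 0 < b := hm.trans_le hb
  have h₁ : 1 / (a ^ 2 * b) ≤ 1 / m ^ 3 := by
    apply one_div_le_one_div_of_le (by positivity)
    calc m ^ 3 = m ^ 2 * m := by ring
      _ ≤ a ^ 2 * b := by gcongr
  have h₂ : 1 / (a * b ^ 2) ≤ 1 / m ^ 3 := by
    apply one_div_le_one_div_of_le (by positivity)
    calc m ^ 3 = m * m ^ 2 := by ring
      _ ≤ a * b ^ 2 := by gcongr
  calc (A / a) ^ 2 - A ^ 2 / b ^ 2
      = A ^ 2 * ((b - a) * (1 / (a ^ 2 * b) + 1 / (a * b ^ 2))) := by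
        field_simp
        ring
    _ ≤ A ^ 2 * (d * (1 / m ^ 3 + 1 / m ^ 3)) := by gcongr
    _ = 2 * A ^ 2 * d / m ^ 3 := by ring

theorem abs_sqrt_sub_sqrt_le {u v B : ℝ} (hu : u ≤ B) (hv : v ≤ B) : |√u - √v| ≤ √B :=
  abs_sub_le_of_nonneg_of_le (Real.sqrt_nonneg _) (Real.sqrt_le_sqrt hu)
    (Real.sqrt_nonneg _) (Real.sqrt_le_sqrt hv)

/-- Quadrature error control on the interval containing the resonant point:
for `N ≥ 1`, `θ > 0`, `0 < h_min ≤ h_max` there is a constant `C > 0`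
(one may take `C = √2·Nπ·h_max^{3/2}/(h_min³·√θ)`) such that for every `η > 0`,
`k > 0` and every `h` differentiable on `[x*, z]` with `θη ≤ h' ≤ η` and
`h_min ≤ h ≤ h_max` there, and `h(x*) = Nπ/k`, one has
`∫_{x*}^{z} |k_N(t) − k_N(z)| dt ≤ C·η^{1/2}·(z − x*)^{3/2}`,
where `k_N(t) = √(k² − N²π²/h(t)²)`. -/
theorem resonant_interval_quadrature_error
    (N : ℕ) (hN : 1 ≤ N) (θ h_min h_max : ℝ)
    (hθ : 0 < θ) (hmin : 0 < h_min) (hmm : h_min ≤ h_max) :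
    ∃ C : ℝ, 0 < C ∧
      C = Real.sqrt 2 * N * Real.pi * h_max ^ ((3 : ℝ) / 2) /
        (h_min ^ 3 * Real.sqrt θ) ∧
      ∀ (η k : ℝ), 0 < η → 0 < k →
      ∀ (xstar z : ℝ), xstar ≤ z →
      ∀ (h h' : ℝ → ℝ),
        (∀ t ∈ Set.Icc xstar z, HasDerivAt h (h' t) t) →
        (∀ t ∈ Set.Icc xstar z, θ * η ≤ h' t) →
        (∀ t ∈ Set.Icc xstar z, h' t ≤ η) →
        (∀ t ∈ Set.Icc xstar z, h_min ≤ h t) →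
        (∀ t ∈ Set.Icc xstar z, h t ≤ h_max) →
        h xstar = N * Real.pi / k →
        ∫ t in xstar..z,
            |Real.sqrt (k ^ 2 - N ^ 2 * Real.pi ^ 2 / (h t) ^ 2) -
              Real.sqrt (k ^ 2 - N ^ 2 * Real.pi ^ 2 / (h z) ^ 2)| ≤
          C * η ^ ((1 : ℝ) / 2) * (z - xstar) ^ ((3 : ℝ) / 2) := by
  have hmax : 0 < h_max := hmin.trans_le hmm
  have hN0 : (0 : ℝ) < N := by exact_mod_cast hN
  refine ⟨_, by positivity, rfl, ?_⟩
  intro η k hη hk xstar z hxz h h' hderiv hlow hupp hge hle hres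
  set A : ℝ := N * Real.pi with hA
  have hA0 : 0 < A := by positivity
  have hL : 0 ≤ z - xstar := sub_nonneg.2 hxz
  have hx : xstar ∈ Set.Icc xstar z := Set.left_mem_Icc.2 hxz
  have hθ1 : θ ≤ 1 := by
    have := (hlow _ hx).trans (hupp _ hx)
    exact le_of_mul_le_mul_right (by simpa using this) hη
  have hkA : k = A / h xstar := by
    rw [hres]
    field_simp
  have hincr : ∀ t ∈ Set.Icc xstar z, h t - h xstar ≤ η * (z - xstar) := by
    intro t ht
    have hmvt : h t - h xstar ≤ η * (t - xstar) := by
      refine (convex_Icc xstar z).image_sub_le_mul_sub_of_deriv_le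
        (fun s hs => (hderiv s hs).continuousAt.continuousWithinAt)
        (fun s hs => (hderiv s (interior_subset hs)).differentiableAt.differentiableWithinAt)
        (fun s hs => ?_) _ hx _ ht ht.1
      rw [(hderiv s (interior_subset hs)).deriv]
      exact hupp s (interior_subset hs)
    exact hmvt.trans (by gcongr; exact ht.2)
  have hbound : ∀ t ∈ Set.Icc xstar z,
      k ^ 2 - N ^ 2 * Real.pi ^ 2 / (h t) ^ 2 ≤
        2 * A ^ 2 * (η * (z - xstar)) / h_min ^ 3 := by
    intro t ht
    rw [← mul_pow, ← hA, hkA]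
    exact div_sq_sub_div_sq_le hmin (hge _ hx) (hge t ht) (by positivity) (hincr t ht)
  have hint := intervalIntegral.norm_integral_le_of_norm_le_const (a := xstar) (b := z)
    (f := fun t => |Real.sqrt (k ^ 2 - N ^ 2 * Real.pi ^ 2 / (h t) ^ 2) -
      Real.sqrt (k ^ 2 - N ^ 2 * Real.pi ^ 2 / (h z) ^ 2)|)
    (C := √(2 * A ^ 2 * (η * (z - xstar)) / h_min ^ 3)) (fun t ht => by
      rw [Set.uIoc_of_le hxz] at ht
      rw [Real.norm_eq_abs, abs_abs]
      exact abs_sqrt_sub_sqrt_le (hbound t ⟨ht.1.le, ht.2⟩)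
        (hbound z (Set.right_mem_Icc.2 hxz)))
  refine (le_abs_self _).trans (hint.trans ?_)
  have hsqrt : √(2 * A ^ 2 * (η * (z - xstar)) / h_min ^ 3) =
      √2 * A * (√η * √(z - xstar)) / (h_min * √h_min) := by
    rw [Real.sqrt_div (by positivity), Real.sqrt_mul (by positivity),
      Real.sqrt_mul (by positivity), Real.sqrt_sq hA0.le, Real.sqrt_mul hη.le,
      pow_succ h_min 2, Real.sqrt_mul (by positivity), Real.sqrt_sq hmin.le]
  have hcoef : 1 / (h_min * √h_min) ≤ h_max * √h_max / (h_min ^ 3 * √θ) := by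
    rw [div_le_div_iff₀ (by positivity) (by positivity), one_mul]
    calc h_min ^ 3 * √θ ≤ h_min ^ 3 * 1 := by
          gcongr
          exact Real.sqrt_le_one.2 hθ1
      _ = h_min * √h_min * (h_min * √h_min) := by
          linear_combination (-h_min ^ 2) * Real.mul_self_sqrt hmin.le
      _ ≤ h_max * √h_max * (h_min * √h_min) := by gcongr
  rw [hsqrt, rpow_three_halves hmax.le, rpow_three_halves hL, ← Real.sqrt_eq_rpow,
    abs_of_nonneg hL]
  calc √2 * A * (√η * √(z - xstar)) / (h_min * √h_min) * (z - xstar)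
      = √2 * A * (√η * √(z - xstar)) * (z - xstar) * (1 / (h_min * √h_min)) := by ring
    _ ≤ √2 * A * (√η * √(z - xstar)) * (z - xstar) *
        (h_max * √h_max / (h_min ^ 3 * √θ)) := by gcongr
    _ = _ := by rw [hA]; ring
end

section
/- Let a < b be reals and let g : [a, b] → ℝ be continuous, concave and monotone nondecreasing on [a, b]. Then |∫_a^b g(x) dx − (b − a)·(g(a) + 3·g(b))/4| ≤ (b − a)·(g(b) − g(a))/4. -/
open Real Set intervalIntegral

/-- A concave function on `[a, b]` dominates its chord. -/
theorem ConcaveOn.chord_le {a b : ℝ} (hab : a < b) {g : ℝ → ℝ}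
    (hg : ConcaveOn ℝ (Set.Icc a b) g) {x : ℝ} (hx : x ∈ Set.Icc a b) :
    g a + (g b - g a) / (b - a) * (x - a) ≤ g x := by
  have hba : 0 < b - a := sub_pos.2 hab
  have h := hg.2 (Set.left_mem_Icc.2 hab.le) (Set.right_mem_Icc.2 hab.le)
    (div_nonneg (sub_nonneg.2 hx.2) hba.le) (div_nonneg (sub_nonneg.2 hx.1) hba.le)
    (by field_simp; ring)
  simp only [smul_eq_mul] at h
  have hpt : (b - x) / (b - a) * a + (x - a) / (b - a) * b = x := by
    field_simp
    ring
  rw [hpt] at h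
  refine le_trans (le_of_eq ?_) h
  field_simp
  ring

/-- The trapezoidal rule underestimates the integral of a concave function. -/
theorem ConcaveOn.trapezoid_le_integral {a b : ℝ} (hab : a < b) {g : ℝ → ℝ}
    (hg : ConcaveOn ℝ (Set.Icc a b) g) (hint : IntervalIntegrable g MeasureTheory.volume a b) :
    (b - a) * (g a + g b) / 2 ≤ ∫ x in a..b, g x := by
  have hba : b - a ≠ 0 := (sub_pos.2 hab).ne'
  have hchord : (∫ x in a..b, (g a + (g b - g a) / (b - a) * (x - a))) =
      (b - a) * (g a + g b) / 2 := by
    rw [intervalIntegral.integral_add (by simp)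
      (Continuous.intervalIntegrable (by fun_prop) _ _),
      intervalIntegral.integral_const_mul,
      intervalIntegral.integral_sub (Continuous.intervalIntegrable (by fun_prop) _ _) (by simp)]
    simp only [intervalIntegral.integral_const, integral_id, smul_eq_mul]
    field_simp
    ring
  rw [← hchord]
  exact intervalIntegral.integral_mono_on hab.le
    (Continuous.intervalIntegrable (by fun_prop) _ _) hint fun x hx => hg.chord_le hab hx

/-- The right-endpoint rectangle rule overestimates the integral of a monotone function. -/
theorem MonotoneOn.integral_le_right_rectangle {a b : ℝ} (hab : a ≤ b) {g : ℝ → ℝ}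
    (hg : MonotoneOn g (Set.Icc a b)) (hint : IntervalIntegrable g MeasureTheory.volume a b) :
    (∫ x in a..b, g x) ≤ (b - a) * g b := by
  have h := intervalIntegral.integral_mono_on hab hint
    (intervalIntegrable_const (c := g b)) fun x hx => hg hx (Set.right_mem_Icc.2 hab) hx.2
  simpa using h

/-- Error bound for the mixed quadrature rule (mean of the trapezoidal rule and
the right-endpoint rectangle rule) for a continuous, concave, nondecreasing
integrand: `|∫_a^b g − (b − a)(g(a) + 3g(b))/4| ≤ (b − a)(g(b) − g(a))/4`. -/
theorem mixed_rule_error_bound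
    (a b : ℝ) (hab : a < b) (g : ℝ → ℝ)
    (hcont : ContinuousOn g (Set.Icc a b))
    (hconc : ConcaveOn ℝ (Set.Icc a b) g)
    (hmono : MonotoneOn g (Set.Icc a b)) :
    |(∫ x in a..b, g x) - (b - a) * (g a + 3 * g b) / 4| ≤
      (b - a) * (g b - g a) / 4 := by
  have hint := hcont.intervalIntegrable_of_Icc (μ := MeasureTheory.volume) hab.le
  have hlower := hconc.trapezoid_le_integral hab hint
  have hupper := hmono.integral_le_right_rectangle hab.le hint
  rw [abs_le]
  constructor <;> linarith
end

section
/- Let h : ℝ → ℝ be continuous, nondecreasing and positive, let N ≥ 1 be an integer, let 0 < k < k', and let x*' ≤ x* ≤ x^meas be reals with h(x*) = Nπ/k and h(x*') = Nπ/k'. Then ζ(k) ≤ ζ(k'), where ζ(k) := ∫_{x*}^{x^meas} √(k² − N²π²/h(x)²) dx and ζ(k') := ∫_{x*'}^{x^meas} √(k'² − N²π²/h(x)²) dx. (The integrands are nonnegative real numbers since h(x) ≥ Nπ/k for x ≥ x* and h(x) ≥ Nπ/k' for x ≥ x*'.) -/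
open Real Set intervalIntegral

/-- The local wavenumber depends continuously on the position. -/
theorem continuous_sqrt_sub_div_sq {h : ℝ → ℝ} (hcont : Continuous h) (hpos : ∀ x, 0 < h x)
    (a c : ℝ) : Continuous fun x => Real.sqrt (a - c / (h x) ^ 2) :=
  (continuous_const.sub (continuous_const.div (hcont.pow 2)
    fun x => (pow_pos (hpos x) 2).ne')).sqrt

/-- Monotonicity of the accumulated phase `ζ` in the frequency: if `h` is
continuous, nondecreasing and positive, `0 < k < k'`, and `x*' ≤ x* ≤ x^meas`
are resonant points with `h(x*) = Nπ/k` and `h(x*') = Nπ/k'`, then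
`∫_{x*}^{x^meas} √(k² − N²π²/h(x)²) dx ≤ ∫_{x*'}^{x^meas} √(k'² − N²π²/h(x)²) dx`. -/
theorem zeta_monotone
    (h : ℝ → ℝ) (hcont : Continuous h) (hmono : Monotone h)
    (hpos : ∀ x, 0 < h x)
    (N : ℕ) (hN : 1 ≤ N) (k k' : ℝ) (hk : 0 < k) (hkk : k < k')
    (xstar' xstar xmeas : ℝ) (hx1 : xstar' ≤ xstar) (hx2 : xstar ≤ xmeas)
    (hres : h xstar = N * Real.pi / k) (hres' : h xstar' = N * Real.pi / k') :
    (∫ x in xstar..xmeas, Real.sqrt (k ^ 2 - N ^ 2 * Real.pi ^ 2 / (h x) ^ 2)) ≤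
      ∫ x in xstar'..xmeas, Real.sqrt (k' ^ 2 - N ^ 2 * Real.pi ^ 2 / (h x) ^ 2) := by
  have hint (κ a b : ℝ) : IntervalIntegrable
      (fun x => Real.sqrt (κ ^ 2 - N ^ 2 * Real.pi ^ 2 / (h x) ^ 2)) MeasureTheory.volume a b :=
    (continuous_sqrt_sub_div_sq hcont hpos _ _).intervalIntegrable a b
  calc (∫ x in xstar..xmeas, Real.sqrt (k ^ 2 - N ^ 2 * Real.pi ^ 2 / (h x) ^ 2))
      ≤ ∫ x in xstar..xmeas, Real.sqrt (k' ^ 2 - N ^ 2 * Real.pi ^ 2 / (h x) ^ 2) :=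
        intervalIntegral.integral_mono_on hx2 (hint k _ _) (hint k' _ _)
          fun x _ => Real.sqrt_le_sqrt (by gcongr)
    _ ≤ ∫ x in xstar'..xmeas, Real.sqrt (k' ^ 2 - N ^ 2 * Real.pi ^ 2 / (h x) ^ 2) := by
        rw [← intervalIntegral.integral_add_adjacent_intervals
          (hint k' xstar' xstar) (hint k' xstar xmeas)]
        exact le_add_of_nonneg_left
          (intervalIntegral.integral_nonneg hx1 fun x _ => Real.sqrt_nonneg _)
end
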